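/- Let K ⊂ ℝ^N be convex, symmetric, containing 0 with nonempty interior, let 1 < p < ∞, m ∈ ℕ, and f ∈ C_c^{m+1}(ℝ^N). Let (ρ_ε) be nonnegative functions on [0,∞) with ∫_0^∞ r^{N-1} ρ_ε(r) dr = 1 and lim_{ε→0} ∫_δ^∞ r^{N-1} ρ_ε(r) dr = 0 for every δ > 0. Then lim_{ε→0} ∫_{ℝ^N}∫_{ℝ^N} |R^m f(x,y)|^p / ‖x−y‖_K^{mp} · ρ_ε(‖x−y‖_K) dx dy = (N+mp)/m^{mp} ∫_{ℝ^N} ∫_K |D^m f(x)(y,…,y)|^p dy dx. -/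

import Mathlib

open MeasureTheory Filter Set

noncomputable section

abbrev E (N : ℕ) : Type := EuclideanSpace ℝ (Fin N)

noncomputable def Rm {N : ℕ} (m : ℕ) (f : E N → ℝ) (x y : E N) : ℝ :=
  ∑ j ∈ Finset.range (m + 1), (-1 : ℝ) ^ j * (m.choose j : ℝ) *
    f ((((m - j : ℕ) : ℝ) / (m : ℝ)) • x + ((j : ℝ) / (m : ℝ)) • y)

open scoped ENNReal NNReal in
lemma bbm_polar_Iic {N : ℕ} (hN : 0 < N) (γ : E N → ℝ) (hγc : Continuous γ)
    (hγpos : ∀ x, x ≠ 0 → 0 < γ x) (hγs : ∀ t : ℝ, 0 < t → ∀ x, γ (t • x) = t * γ x)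
    (g : E N → ℝ≥0) (hg : Measurable g) (s : ℝ) (hs : 0 ≤ s)
    (hgs : ∀ t : ℝ, 0 < t → ∀ x, (g (t • x) : ℝ≥0∞) = ENNReal.ofReal (t ^ s) * g x) (b : ℝ) :
    ((volume : Measure (E N)).withDensity (fun x => (g x : ℝ≥0∞))).map γ (Iic b) =
      ((∫⁻ x in {x | γ x ≤ 1}, (g x : ℝ≥0∞)) * ENNReal.ofReal (N + s)) •
        (volume.restrict (Ioi (0:ℝ))).withDensity
          (fun r => ((r ^ ((N:ℝ) + s - 1)).toNNReal : ℝ≥0∞)) (Iic b) := by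
  have hN' : (1:ℝ) ≤ N := by exact_mod_cast hN
  have : Nonempty (Fin N) := ⟨⟨0, hN⟩⟩
  rw [Measure.map_apply hγc.measurable measurableSet_Iic,
    withDensity_apply _ (hγc.measurable measurableSet_Iic),
    withDensity_apply _ measurableSet_Iic, Measure.restrict_restrict measurableSet_Iic]
  rcases le_or_gt b 0 with hb | hb
  · have h1 : Iic b ∩ Ioi (0:ℝ) = ∅ := by
      ext x; simp; intro h; linarith
    have h2 : volume (γ ⁻¹' Iic b) = 0 := by
      apply measure_mono_null (t := {0})
      · intro x hx
        by_contra h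
        have := hγpos x h
        simp at hx
        linarith
      · simp
    rw [h1, Measure.restrict_eq_zero.2 h2]
    simp
  · have h1 : Iic b ∩ Ioi (0:ℝ) = Ioc 0 b := by
      ext x; simp [and_comm]
    rw [h1]
    have h3 : ∫⁻ r in Ioc 0 b, ((r ^ ((N:ℝ) + s - 1)).toNNReal : ℝ≥0∞) =
        ENNReal.ofReal (b ^ ((N:ℝ) + s) / (N + s)) := by
      have h4 : ∫ r in Ioc 0 b, r ^ ((N:ℝ) + s - 1) = b ^ ((N:ℝ) + s) / (N + s) := by
        rw [← intervalIntegral.integral_of_le hb.le, integral_rpow (Or.inl (by linarith))]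
        rw [Real.zero_rpow (by linarith)]
        simp
      rw [← h4, ofReal_integral_eq_lintegral_ofReal]
      · rfl
      · exact ((intervalIntegral.intervalIntegrable_rpow' (by linarith)).1)
      · refine (ae_restrict_iff' measurableSet_Ioc).2 (ae_of_all _ fun r hr => ?_)
        exact Real.rpow_nonneg hr.1.le _
    rw [h3]
    have h5 : ∫⁻ x in γ ⁻¹' Iic b, (g x : ℝ≥0∞) =
        ENNReal.ofReal (b ^ ((N:ℝ) + s)) * ∫⁻ x in {x | γ x ≤ 1}, (g x : ℝ≥0∞) := by
      have hm1 : MeasurableSet (γ ⁻¹' Iic b) := hγc.measurable measurableSet_Iic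
      have hm2 : MeasurableSet {x | γ x ≤ 1} := measurableSet_le hγc.measurable measurable_const
      have hmap := Measure.map_addHaar_smul (volume : Measure (E N)) hb.ne'
      have hme : Measurable (fun x : E N => (γ ⁻¹' Iic b).indicator (fun x => (g x : ℝ≥0∞)) x) :=
        (hg.coe_nnreal_ennreal).indicator hm1
      have h6 := lintegral_map (μ := (volume : Measure (E N))) hme
        (measurable_const_smul b : Measurable (fun x : E N => b • x))
      rw [hmap, lintegral_smul_measure] at h6
      rw [← lintegral_indicator hm1, ← lintegral_indicator hm2]
      have h7 : ∀ x : E N, (γ ⁻¹' Iic b).indicator (fun x => (g x : ℝ≥0∞)) (b • x) =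
          ENNReal.ofReal (b ^ s) * {x | γ x ≤ 1}.indicator (fun x => (g x : ℝ≥0∞)) x := by
        intro x
        by_cases hx : γ x ≤ 1
        · rw [indicator_of_mem, indicator_of_mem, hgs b hb]
          · exact hx
          · simp only [mem_preimage, mem_Iic, hγs b hb]
            nlinarith
        · rw [indicator_of_notMem, indicator_of_notMem, mul_zero]
          · exact hx
          · simp only [mem_preimage, mem_Iic, hγs b hb]
            push Not at hx ⊢
            nlinarith
      simp_rw [h7] at h6
      rw [lintegral_const_mul _ ((hg.coe_nnreal_ennreal).indicator hm2)] at h6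
      rw [Real.rpow_add hb, ENNReal.ofReal_mul (by positivity), mul_assoc, ← h6, smul_eq_mul,
        ← mul_assoc, ← ENNReal.ofReal_mul (by positivity)]
      rw [finrank_euclideanSpace, Fintype.card_fin, Real.rpow_natCast, abs_of_pos (by positivity),
        mul_inv_cancel₀ (by positivity)]
      simp
    rw [h5, smul_eq_mul, mul_assoc, ← ENNReal.ofReal_mul (by positivity),
      mul_div_cancel₀ _ (by linarith), mul_comm]

open scoped ENNReal NNReal in
lemma bbm_polar {N : ℕ} (hN : 0 < N) (γ : E N → ℝ) (hγc : Continuous γ)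
    (hγpos : ∀ x, x ≠ 0 → 0 < γ x) (hγs : ∀ t : ℝ, 0 < t → ∀ x, γ (t • x) = t * γ x)
    (g : E N → ℝ≥0) (hg : Measurable g) (s : ℝ) (hs : 0 ≤ s)
    (hgs : ∀ t : ℝ, 0 < t → ∀ x, (g (t • x) : ℝ≥0∞) = ENNReal.ofReal (t ^ s) * g x)
    (hfin : ∫⁻ x in {x | γ x ≤ 1}, (g x : ℝ≥0∞) ≠ ∞) :
    ((volume : Measure (E N)).withDensity (fun x => (g x : ℝ≥0∞))).map γ =
      ((∫⁻ x in {x | γ x ≤ 1}, (g x : ℝ≥0∞)) * ENNReal.ofReal (N + s)) •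
        (volume.restrict (Ioi (0:ℝ))).withDensity
          (fun r => ((r ^ ((N:ℝ) + s - 1)).toNNReal : ℝ≥0∞)) := by
  have key := bbm_polar_Iic hN γ hγc hγpos hγs g hg s hs hgs
  have hN' : (1:ℝ) ≤ N := by exact_mod_cast hN
  have hfinb : ∀ b : ℝ, ((volume : Measure (E N)).withDensity
      (fun x => (g x : ℝ≥0∞))).map γ (Iic b) ≠ ∞ := by
    intro b
    rw [key, smul_eq_mul]
    refine ENNReal.mul_ne_top (ENNReal.mul_ne_top hfin ENNReal.ofReal_ne_top) ?_
    rw [withDensity_apply _ measurableSet_Iic, Measure.restrict_restrict measurableSet_Iic]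
    have h1 : Iic b ∩ Ioi (0:ℝ) = Ioc 0 b := by
      ext x; simp [and_comm]
    rw [h1]
    have h2 : IntegrableOn (fun r : ℝ => r ^ ((N:ℝ) + s - 1)) (Ioc 0 b) :=
      (intervalIntegral.intervalIntegrable_rpow' (by linarith)).1
    exact h2.lintegral_lt_top.ne
  apply Measure.ext_of_Ioc'
  · intro a b hab
    exact ne_top_of_le_ne_top (hfinb b) (measure_mono Ioc_subset_Iic_self)
  · intro a b hab
    have hd : Ioc a b = Iic b \ Iic a := by
      ext x; simp [and_comm]
    rw [hd, measure_sdiff (Iic_subset_Iic.2 hab.le) measurableSet_Iic.nullMeasurableSet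
      (hfinb a), measure_sdiff (Iic_subset_Iic.2 hab.le) measurableSet_Iic.nullMeasurableSet,
      key b, key a]
    · rfl
    · have := hfinb a
      rw [key a] at this
      exact this

open scoped ENNReal NNReal in
lemma bbm_polar_integral {N : ℕ} (hN : 0 < N) (γ : E N → ℝ) (hγc : Continuous γ)
    (hγpos : ∀ x, x ≠ 0 → 0 < γ x) (hγs : ∀ t : ℝ, 0 < t → ∀ x, γ (t • x) = t * γ x)
    (g : E N → ℝ) (hg0 : ∀ x, 0 ≤ g x) (hg : Measurable g) (s : ℝ) (hs : 0 ≤ s)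
    (hgs : ∀ t : ℝ, 0 < t → ∀ x, g (t • x) = t ^ s * g x)
    (hfin : IntegrableOn g {x | γ x ≤ 1})
    (H : ℝ → ℝ) (hH : IntegrableOn (fun r => r ^ ((N:ℝ) + s - 1) * H r) (Ioi 0)) :
    Integrable (fun x => g x * H (γ x)) ∧
    ∫ x, g x * H (γ x) = ((N:ℝ) + s) * (∫ x in {x | γ x ≤ 1}, g x) *
      ∫ r in Ioi (0:ℝ), r ^ ((N:ℝ) + s - 1) * H r := by
  have hN' : (1:ℝ) ≤ N := by exact_mod_cast hN
  have hgm : Measurable (fun x => (g x).toNNReal) := hg.real_toNNReal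
  have hI : (∫⁻ x in {x | γ x ≤ 1}, ((g x).toNNReal : ℝ≥0∞)) =
      ENNReal.ofReal (∫ x in {x | γ x ≤ 1}, g x) := by
    rw [ofReal_integral_eq_lintegral_ofReal hfin (ae_of_all _ hg0)]
    rfl
  have hP := bbm_polar hN γ hγc hγpos hγs (fun x => (g x).toNNReal) hgm s hs (by
    intro t ht x
    change ENNReal.ofReal (g (t • x)) = _ * ENNReal.ofReal (g x)
    rw [hgs t ht, ENNReal.ofReal_mul (by positivity)]) (by rw [hI]; simp)
  rw [hI] at hP
  set A : ℝ := ∫ x in {x | γ x ≤ 1}, g x with hA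
  have hA0 : 0 ≤ A := integral_nonneg hg0
  have hwm : Measurable (fun r : ℝ => (r ^ ((N:ℝ) + s - 1)).toNNReal) := by fun_prop
  have hcong : ∀ᵐ r ∂(volume.restrict (Ioi (0:ℝ))),
      r ^ ((N:ℝ) + s - 1) * H r = (r ^ ((N:ℝ) + s - 1)).toNNReal • H r := by
    refine (ae_restrict_iff' measurableSet_Ioi).2 (ae_of_all _ fun r hr => ?_)
    rw [NNReal.smul_def, Real.coe_toNNReal _ (Real.rpow_nonneg (le_of_lt hr) _), smul_eq_mul]
  have hH1 : Integrable H ((volume.restrict (Ioi (0:ℝ))).withDensity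
          (fun r => ((r ^ ((N:ℝ) + s - 1)).toNNReal : ℝ≥0∞))) := by
    rw [integrable_withDensity_iff_integrable_smul hwm]
    exact hH.congr hcong
  have hH2 : Integrable H (((volume : Measure (E N)).withDensity
      (fun x => ((g x).toNNReal : ℝ≥0∞))).map γ) := by
    rw [hP]
    exact hH1.smul_measure (ENNReal.mul_ne_top ENNReal.ofReal_ne_top ENNReal.ofReal_ne_top)
  have hcg : ∀ x, (g x).toNNReal • H (γ x) = g x * H (γ x) := by
    intro x
    rw [NNReal.smul_def, Real.coe_toNNReal _ (hg0 x), smul_eq_mul]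
  constructor
  · rw [integrable_map_measure hH2.1 hγc.measurable.aemeasurable,
      integrable_withDensity_iff_integrable_smul hgm] at hH2
    refine hH2.congr (ae_of_all _ fun x => hcg x)
  · have h1 := integral_map (hγc.measurable.aemeasurable) hH2.1
    rw [integral_withDensity_eq_integral_smul hgm, hP, integral_smul_measure,
      integral_withDensity_eq_integral_smul hwm, ← integral_congr_ae hcong] at h1
    simp_rw [hcg] at h1
    rw [← h1, ENNReal.toReal_mul, ENNReal.toReal_ofReal hA0, ENNReal.toReal_ofReal (by linarith),
      smul_eq_mul]
    ring

lemma bbm_altsum (m k : ℕ) (hk : k ≤ m) :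
    ∑ j ∈ Finset.range (m + 1), (-1 : ℝ) ^ j * (m.choose j : ℝ) * (j : ℝ) ^ k =
      if k = m then (-1) ^ m * (m.factorial : ℝ) else 0 := by
  have h1 := fwdDiff_iter_eq_sum_shift (h := (1:ℝ)) (fun r : ℝ => r ^ k) m 0
  have h2 : ∑ j ∈ Finset.range (m + 1), (-1 : ℝ) ^ j * (m.choose j : ℝ) * (j : ℝ) ^ k =
      (-1) ^ m * ∑ j ∈ Finset.range (m + 1),
        ((-1 : ℤ) ^ (m - j) * m.choose j) • (fun r : ℝ => r ^ k) (0 + j • (1:ℝ)) := by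
    rw [Finset.mul_sum]
    refine Finset.sum_congr rfl fun j hj => ?_
    have hj' : j ≤ m := by simpa [Nat.lt_succ_iff] using hj
    obtain ⟨i, rfl⟩ := Nat.exists_eq_add_of_le hj'
    simp only [nsmul_eq_mul, mul_one, zero_add, zsmul_eq_mul, Nat.add_sub_cancel_left]
    push_cast
    have : (-1:ℝ) ^ (j + i) * (-1) ^ i = (-1) ^ j := by
      rw [pow_add, mul_assoc, ← mul_pow]; simp
    rw [← this]; ring
  rw [h2, ← h1]
  split_ifs with h
  · subst h
    rw [fwdDiff_iter_eq_factorial]; simp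
  · rw [fwdDiff_iter_pow_eq_zero_of_lt (lt_of_le_of_ne hk h)]; simp

lemma bbm_Rm_eq {N : ℕ} (m : ℕ) (hm : 0 < m) (f : E N → ℝ) (x h : E N) :
    Rm m f x (x + h) = ∑ j ∈ Finset.range (m + 1), (-1 : ℝ) ^ j * (m.choose j : ℝ) *
      f (x + ((j : ℝ) / (m : ℝ)) • h) := by
  unfold Rm
  refine Finset.sum_congr rfl fun j hj => ?_
  have hj' : j ≤ m := by simpa [Nat.lt_succ_iff] using hj
  congr 2
  rw [smul_add, ← add_assoc, ← add_smul, Nat.cast_sub hj', ← add_div, sub_add_cancel, div_self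
    (by positivity), one_smul]

lemma bbm_line {N : ℕ} (n k : ℕ) (hk : k ≤ n) (f : E N → ℝ) (hf : ContDiff ℝ n f) (x h : E N)
    (t : ℝ) : iteratedDeriv k (fun t : ℝ => f (x + t • h)) t =
      iteratedFDeriv ℝ k f (x + t • h) (fun _ => h) := by
  have hf' : ContDiff ℝ n (fun z => f (x + z)) := hf.comp (contDiff_const.add contDiff_id)
  have h1 := ContinuousLinearMap.iteratedFDeriv_comp_right
    (ContinuousLinearMap.toSpanSingleton ℝ h) hf' t (i := k) (by exact_mod_cast hk)
  have h2 : (fun t : ℝ => f (x + t • h)) =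
      (fun z => f (x + z)) ∘ (ContinuousLinearMap.toSpanSingleton ℝ h) := by
    ext t; simp
  rw [iteratedDeriv_eq_iteratedFDeriv, h2, h1, iteratedFDeriv_comp_add_left]
  simp

lemma bbm_taylor {N : ℕ} (m : ℕ) (hm : 0 < m) (f : E N → ℝ) (hf : ContDiff ℝ (m + 1) f)
    (hsupp : HasCompactSupport f) : ∃ C : ℝ, 0 ≤ C ∧ ∀ x h : E N,
      |Rm m f x (x + h) - (-1) ^ m / (m:ℝ) ^ m * iteratedFDeriv ℝ m f x (fun _ => h)| ≤
        C * ‖h‖ ^ (m + 1) := by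
  have hf' : ContDiff ℝ ((m + 1 : ℕ) : WithTop ℕ∞) f := by exact_mod_cast hf
  obtain ⟨M, hM⟩ := (hf'.continuous_iteratedFDeriv (m := m + 1) le_rfl).bounded_above_of_compact_support
    (hsupp.iteratedFDeriv (m + 1))
  have hM0 : 0 ≤ M := (norm_nonneg _).trans (hM 0)
  refine ⟨∑ j ∈ Finset.range (m + 1), (m.choose j : ℝ) * M, by positivity, fun x h => ?_⟩
  set φ : ℝ → ℝ := fun t => f (x + t • h) with hφ
  have hφc : ContDiff ℝ (m + 1) φ := by
    apply hf.comp
    fun_prop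
  have hud : UniqueDiffOn ℝ (Icc (0:ℝ) 1) := uniqueDiffOn_Icc zero_lt_one
  have hder : ∀ k ≤ m + 1, ∀ t ∈ Icc (0:ℝ) 1, iteratedDerivWithin k φ (Icc 0 1) t =
      iteratedFDeriv ℝ k f (x + t • h) (fun _ => h) := by
    intro k hk t ht
    rw [← bbm_line (m+1) k hk f hf' x h t]
    apply iteratedDerivWithin_eq_iteratedDeriv hud _ ht
    exact (hφc.of_le (by exact_mod_cast hk)).contDiffAt
  have hrem : ∀ t ∈ Icc (0:ℝ) 1, |φ t - ∑ k ∈ Finset.range (m + 1),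
      t ^ k * ((k.factorial : ℝ)⁻¹ * iteratedFDeriv ℝ k f x (fun _ => h))| ≤ M * ‖h‖ ^ (m + 1) := by
    intro t ht
    have h1 := taylor_mean_remainder_bound (C := M * ‖h‖ ^ (m + 1)) zero_le_one
      hφc.contDiffOn ht (by
        intro y hy
        rw [hder (m + 1) le_rfl y hy]
        refine (ContinuousMultilinearMap.le_opNorm _ _).trans ?_
        simp only [Finset.prod_const, Finset.card_univ, Fintype.card_fin]
        gcongr
        exact hM _)
    have h2 : taylorWithinEval φ m (Icc 0 1) 0 t = ∑ k ∈ Finset.range (m + 1),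
      t ^ k * ((k.factorial : ℝ)⁻¹ * iteratedFDeriv ℝ k f x (fun _ => h)) := by
      rw [taylor_within_apply]
      refine Finset.sum_congr rfl fun k hk => ?_
      rw [hder k (by simp at hk; omega) 0 (by simp)]
      simp
      ring
    rw [h2, Real.norm_eq_abs] at h1
    refine h1.trans ?_
    rw [sub_zero]
    apply div_le_of_le_mul₀ (by positivity) (by positivity)
    have h3 : t ^ (m + 1) ≤ 1 := pow_le_one₀ ht.1 ht.2
    have h4 : (1:ℝ) ≤ (m.factorial : ℝ) := by exact_mod_cast Nat.factorial_pos m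
    have : 0 ≤ M * ‖h‖ ^ (m + 1) := by positivity
    calc _ ≤ M * ‖h‖ ^ (m + 1) * 1 := by gcongr
      _ ≤ _ := by gcongr
  have hsum : (-1) ^ m / (m:ℝ) ^ m * iteratedFDeriv ℝ m f x (fun _ => h) =
      ∑ j ∈ Finset.range (m + 1), (-1 : ℝ) ^ j * (m.choose j : ℝ) *
        ∑ k ∈ Finset.range (m + 1), ((j:ℝ) / m) ^ k *
          ((k.factorial : ℝ)⁻¹ * iteratedFDeriv ℝ k f x (fun _ => h)) := by
    simp_rw [Finset.mul_sum]
    rw [Finset.sum_comm]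
    have : ∀ k ∈ Finset.range (m + 1), ∑ j ∈ Finset.range (m + 1),
        (-1 : ℝ) ^ j * (m.choose j : ℝ) * (((j:ℝ) / m) ^ k *
          ((k.factorial : ℝ)⁻¹ * iteratedFDeriv ℝ k f x (fun _ => h))) =
        if k = m then (-1) ^ m / (m:ℝ) ^ m * iteratedFDeriv ℝ m f x (fun _ => h) else 0 := by
      intro k hk
      have h1 := bbm_altsum m k (by simp at hk; omega)
      have h2 : ∑ j ∈ Finset.range (m + 1),
        (-1 : ℝ) ^ j * (m.choose j : ℝ) * (((j:ℝ) / m) ^ k *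
          ((k.factorial : ℝ)⁻¹ * iteratedFDeriv ℝ k f x (fun _ => h))) =
          (∑ j ∈ Finset.range (m + 1), (-1 : ℝ) ^ j * (m.choose j : ℝ) * (j : ℝ) ^ k) *
          (((m:ℝ) ^ k)⁻¹ * ((k.factorial : ℝ)⁻¹ * iteratedFDeriv ℝ k f x (fun _ => h))) := by
        rw [Finset.sum_mul]
        refine Finset.sum_congr rfl fun j _ => ?_
        rw [div_pow]; ring
      rw [h2, h1]
      split_ifs with hkm
      · subst hkm
        have : (k.factorial : ℝ) ≠ 0 := by positivity
        field_simp
      · simp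
    rw [Finset.sum_congr rfl this]
    simp
  rw [bbm_Rm_eq m hm, hsum, ← Finset.sum_sub_distrib, Finset.sum_mul]
  refine (Finset.abs_sum_le_sum_abs _ _).trans (Finset.sum_le_sum fun j hj => ?_)
  rw [← mul_sub, abs_mul, abs_mul, abs_pow, abs_neg, abs_one, one_pow, one_mul, Nat.abs_cast,
    mul_assoc]
  gcongr
  have hj' : (j:ℝ) ≤ m := by exact_mod_cast (by simp at hj; omega : j ≤ m)
  exact hrem _ ⟨by positivity, div_le_one_of_le₀ hj' (by positivity)⟩

lemma bbm_rpow_diff (p : ℝ) (hp : 1 ≤ p) (M a b : ℝ) (ha : |a| ≤ M) (hb : |b| ≤ M) :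
    |(|a| ^ p - |b| ^ p)| ≤ p * M ^ (p - 1) * |a - b| := by
  have h := Convex.norm_image_sub_le_of_norm_hasDerivWithin_le (𝕜 := ℝ)
    (f := fun x : ℝ => x ^ p) (f' := fun x => p * x ^ (p - 1)) (s := Icc 0 M)
    (x := |b|) (y := |a|) (C := p * M ^ (p - 1))
    (fun x hx => (Real.hasDerivAt_rpow_const (Or.inr hp)).hasDerivWithinAt)
    (fun x hx => by
      rw [Real.norm_eq_abs, abs_mul, abs_of_nonneg (by linarith : 0 ≤ p),
        abs_of_nonneg (Real.rpow_nonneg hx.1 _)]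
      gcongr
      · exact hx.1
      · exact hx.2)
    (convex_Icc 0 M) ⟨abs_nonneg _, hb⟩ ⟨abs_nonneg _, ha⟩
  simp only [Real.norm_eq_abs] at h
  refine h.trans ?_
  have hM : 0 ≤ M := (abs_nonneg a).trans ha
  exact mul_le_mul_of_nonneg_left (abs_abs_sub_abs_le a b) (by positivity)

lemma bbm_T_cont {N : ℕ} (m : ℕ) (f : E N → ℝ) (hf : Continuous f) :
    Continuous (fun z : E N × E N => Rm m f z.1 (z.1 + z.2)) := by
  unfold Rm
  fun_prop

lemma bbm_T_supp {N : ℕ} (m : ℕ) (hm : 0 < m) (f : E N → ℝ) (R : ℝ)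
    (hR : ∀ x, R < ‖x‖ → f x = 0) (h : E N) (x : E N) (hx : R + ‖h‖ < ‖x‖) :
    Rm m f x (x + h) = 0 := by
  rw [bbm_Rm_eq m hm]
  refine Finset.sum_eq_zero fun j hj => ?_
  rw [hR, mul_zero]
  have hj' : (j:ℝ) ≤ m := by exact_mod_cast (by simp at hj; omega : j ≤ m)
  have h1 : ‖((j:ℝ) / m) • h‖ ≤ ‖h‖ := by
    rw [norm_smul, Real.norm_of_nonneg (by positivity)]
    exact mul_le_of_le_one_left (norm_nonneg _) (div_le_one_of_le₀ hj' (by positivity))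
  have h2 := norm_sub_le (x + ((j:ℝ) / m) • h) (((j:ℝ) / m) • h)
  rw [add_sub_cancel_right] at h2
  linarith

lemma bbm_cont_int {N : ℕ} (u : E N → ℝ) (hu : Continuous u) (R : ℝ)
    (hR : ∀ x, R < ‖x‖ → u x = 0) (p : ℝ) (hp : 0 < p) :
    Integrable (fun x => |u x| ^ p) := by
  apply Continuous.integrable_of_hasCompactSupport
  · exact hu.abs.rpow_const (fun x => Or.inr hp.le)
  · apply HasCompactSupport.of_support_subset_isCompact (isCompact_closedBall (0 : E N) R)
    intro x hx
    by_contra hc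
    apply hx
    simp only [Metric.mem_closedBall, dist_zero_right, not_le] at hc
    simp [hR x hc, Real.zero_rpow hp.ne']

lemma bbm_int_bound {N : ℕ} (u : E N → ℝ) (R : ℝ)
    (hR : ∀ x, R < ‖x‖ → u x = 0) (C : ℝ) (hC : ∀ x, |u x| ≤ C) :
    |∫ x, u x| ≤ C * (volume : Measure (E N)).real (Metric.closedBall 0 R) := by
  rw [← setIntegral_eq_integral_of_forall_compl_eq_zero (s := Metric.closedBall (0 : E N) R)
    (fun x hx => hR x (by simpa using hx))]
  rw [← Real.norm_eq_abs]
  refine norm_setIntegral_le_of_norm_le_const measure_closedBall_lt_top (fun x _ => ?_)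
  rw [Real.norm_eq_abs]
  exact hC x

lemma bbm_supp_radius {N : ℕ} (m : ℕ) (f : E N → ℝ) (hsupp : HasCompactSupport f) :
    ∃ R : ℝ, (∀ x, R < ‖x‖ → f x = 0) ∧ (∀ x, R < ‖x‖ → iteratedFDeriv ℝ m f x = 0) := by
  obtain ⟨R, hR⟩ := hsupp.isCompact.isBounded.subset_closedBall (0 : E N)
  refine ⟨R, fun x hx => ?_, fun x hx => ?_⟩
  · by_contra h
    have := hR (subset_tsupport _ h)
    simp at this; linarith
  · by_contra h
    have := hR (support_iteratedFDeriv_subset m h)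
    simp at this; linarith

lemma bbm_L_bound {N : ℕ} (m : ℕ) (f : E N → ℝ) (hf : ContDiff ℝ (m + 1) f)
    (hsupp : HasCompactSupport f) : ∃ M : ℝ, 0 ≤ M ∧
      ∀ x h : E N, |iteratedFDeriv ℝ m f x (fun _ => h)| ≤ M * ‖h‖ ^ m := by
  have hf' : ContDiff ℝ ((m + 1 : ℕ) : WithTop ℕ∞) f := by exact_mod_cast hf
  obtain ⟨M, hM⟩ := (hf'.continuous_iteratedFDeriv (m := m)
    (by exact_mod_cast Nat.le_succ m)).bounded_above_of_compact_support
    (hsupp.iteratedFDeriv m)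
  have hM0 : 0 ≤ M := (norm_nonneg _).trans (hM 0)
  refine ⟨M, hM0, fun x h => ?_⟩
  refine (ContinuousMultilinearMap.le_opNorm (iteratedFDeriv ℝ m f x) (fun _ => h)).trans ?_
  simp only [Finset.prod_const, Finset.card_univ, Fintype.card_fin]
  gcongr
  exact hM _

lemma bbm_L_cont {N : ℕ} (m : ℕ) (f : E N → ℝ) (hf : ContDiff ℝ (m + 1) f) :
    Continuous (fun z : E N × E N => iteratedFDeriv ℝ m f z.1 (fun _ => z.2)) := by
  have hf' : ContDiff ℝ ((m + 1 : ℕ) : WithTop ℕ∞) f := by exact_mod_cast hf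
  have h1 := hf'.continuous_iteratedFDeriv (m := m) (by exact_mod_cast Nat.le_succ m)
  have h2 : Continuous (fun z : E N × E N =>
    (iteratedFDeriv ℝ m f z.1, (fun _ : Fin m => z.2))) := by fun_prop
  exact continuous_eval.comp h2

lemma bbm_G_bound {N : ℕ} (m : ℕ) (hm : 0 < m) (p : ℝ) (hp1 : 1 < p) (f : E N → ℝ)
    (hf : Continuous f) (hsupp : HasCompactSupport f) : ∃ C : ℝ, 0 ≤ C ∧
      ∀ h : E N, ∫ x, |Rm m f x (x + h)| ^ p ≤ C := by
  obtain ⟨M, hM⟩ := hf.bounded_above_of_compact_support hsupp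
  obtain ⟨R, hR, -⟩ := bbm_supp_radius m f hsupp
  have hM0 : 0 ≤ M := (norm_nonneg _).trans (hM 0)
  have hint : Integrable f := hf.integrable_of_hasCompactSupport hsupp
  set A : ℝ := ∑ j ∈ Finset.range (m + 1), (m.choose j : ℝ) * M with hA
  have hA0 : 0 ≤ A := by positivity
  have hTle : ∀ x h : E N, |Rm m f x (x + h)| ≤
      ∑ j ∈ Finset.range (m + 1), (m.choose j : ℝ) * |f (x + ((j : ℝ) / (m : ℝ)) • h)| := by
    intro x h
    rw [bbm_Rm_eq m hm]
    refine (Finset.abs_sum_le_sum_abs _ _).trans (Finset.sum_le_sum fun j hj => ?_)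
    rw [abs_mul, abs_mul, abs_pow, abs_neg, abs_one, one_pow, one_mul, Nat.abs_cast]
  refine ⟨A ^ (p - 1) * ∑ j ∈ Finset.range (m + 1), (m.choose j : ℝ) * ∫ x, |f x|,
    mul_nonneg (by positivity) (Finset.sum_nonneg fun j _ => mul_nonneg (by positivity)
      (integral_nonneg fun x => abs_nonneg _)), fun h => ?_⟩
  have hi : ∀ j : ℕ, Integrable (fun x => (m.choose j : ℝ) * |f (x + ((j : ℝ) / (m : ℝ)) • h)|) :=
    fun j => ((hint.comp_add_right _).abs).const_mul _
  calc ∫ x, |Rm m f x (x + h)| ^ p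
      ≤ ∫ x, A ^ (p - 1) * ∑ j ∈ Finset.range (m + 1),
          (m.choose j : ℝ) * |f (x + ((j : ℝ) / (m : ℝ)) • h)| := by
        apply integral_mono
        · exact bbm_cont_int (fun x => Rm m f x (x + h))
            ((bbm_T_cont m f hf).comp (continuous_id.prodMk continuous_const)) (R + ‖h‖)
            (fun x hx => bbm_T_supp m hm f R hR h x hx) p (by linarith)
        · exact (integrable_finsetSum _ fun j _ => hi j).const_mul _
        · intro x
          have h1 : |Rm m f x (x + h)| ≤ A := (hTle x h).trans
            (Finset.sum_le_sum fun j _ => by gcongr; exact hM _)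
          change |Rm m f x (x + h)| ^ p ≤ _
          have h2 : |Rm m f x (x + h)| ^ p =
              |Rm m f x (x + h)| ^ (p - 1) * |Rm m f x (x + h)| := by
            rw [← Real.rpow_add_one' (abs_nonneg _) (by linarith)]; simp
          rw [h2]
          exact mul_le_mul (Real.rpow_le_rpow (abs_nonneg _) h1 (by linarith)) (hTle x h)
            (abs_nonneg _) (by positivity)
    _ = _ := by
        rw [integral_const_mul, integral_finsetSum _ fun j _ => hi j]
        congr 1
        refine Finset.sum_congr rfl fun j _ => ?_
        rw [integral_const_mul]
        congr 1
        exact integral_add_right_eq_self (fun x => |f x|) _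

lemma bbm_g_bound {N : ℕ} (m : ℕ) (p : ℝ) (hp1 : 1 < p) (f : E N → ℝ)
    (hf : ContDiff ℝ (m + 1) f) (hsupp : HasCompactSupport f) : ∃ C : ℝ, 0 ≤ C ∧
      ∀ h : E N, ∫ x, |iteratedFDeriv ℝ m f x (fun _ => h)| ^ p ≤ C * ‖h‖ ^ ((m:ℝ) * p) := by
  obtain ⟨M, hM0, hM⟩ := bbm_L_bound m f hf hsupp
  obtain ⟨R, -, hR⟩ := bbm_supp_radius m f hsupp
  refine ⟨M ^ p * (volume : Measure (E N)).real (Metric.closedBall 0 R), by positivity,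
    fun h => ?_⟩
  have h1 := bbm_int_bound (fun x => |iteratedFDeriv ℝ m f x (fun _ => h)| ^ p) R
    (fun x hx => by simp [hR x hx, Real.zero_rpow (by linarith : p ≠ 0)])
    (M ^ p * ‖h‖ ^ ((m:ℝ) * p)) (fun x => by
      rw [abs_of_nonneg (by positivity), Real.rpow_mul (norm_nonneg _), Real.rpow_natCast,
        ← Real.mul_rpow hM0 (by positivity)]
      gcongr
      exact hM x h)
  refine (le_abs_self _).trans (h1.trans_eq (by ring))

lemma bbm_diff_bound {N : ℕ} (m : ℕ) (hm : 0 < m) (p : ℝ) (hp1 : 1 < p) (f : E N → ℝ)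
    (hf : ContDiff ℝ (m + 1) f) (hsupp : HasCompactSupport f) : ∃ C : ℝ, 0 ≤ C ∧
      ∀ h : E N, ‖h‖ ≤ 1 → |(∫ x, |Rm m f x (x + h)| ^ p) -
        ((m:ℝ) ^ ((m:ℝ) * p))⁻¹ * ∫ x, |iteratedFDeriv ℝ m f x (fun _ => h)| ^ p| ≤
          C * ‖h‖ ^ ((m:ℝ) * p) * ‖h‖ := by
  obtain ⟨M, hM0, hM⟩ := bbm_L_bound m f hf hsupp
  obtain ⟨R, hR, hR'⟩ := bbm_supp_radius m f hsupp
  obtain ⟨C, hC0, hC⟩ := bbm_taylor m hm f hf hsupp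
  have hm1 : (1:ℝ) ≤ m := by exact_mod_cast hm
  refine ⟨p * (C + M) ^ (p - 1) * C * (volume : Measure (E N)).real (Metric.closedBall 0 (R + 1)),
    by positivity, fun h hh => ?_⟩
  have hL : ∀ x, ((m:ℝ) ^ ((m:ℝ) * p))⁻¹ * |iteratedFDeriv ℝ m f x (fun _ => h)| ^ p =
      |(-1) ^ m / (m:ℝ) ^ m * iteratedFDeriv ℝ m f x (fun _ => h)| ^ p := by
    intro x
    rw [abs_mul, abs_div, abs_pow, abs_neg, abs_one, one_pow,
      abs_of_pos (show (0:ℝ) < (m:ℝ) ^ m by positivity),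
      Real.mul_rpow (by positivity) (by positivity), Real.rpow_mul (by positivity),
      Real.rpow_natCast, one_div, Real.inv_rpow (by positivity)]
  rw [← integral_const_mul]
  simp_rw [hL]
  have hcT : Continuous (fun x => Rm m f x (x + h)) :=
    (bbm_T_cont m f hf.continuous).comp (continuous_id.prodMk continuous_const)
  have hcL : Continuous (fun x => (-1) ^ m / (m:ℝ) ^ m * iteratedFDeriv ℝ m f x (fun _ => h)) :=
    continuous_const.mul ((bbm_L_cont m f hf).comp (continuous_id.prodMk continuous_const))
  have hTz : ∀ x, R + 1 < ‖x‖ → Rm m f x (x + h) = 0 :=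
    fun x hx => bbm_T_supp m hm f R hR h x (by linarith)
  have hLz : ∀ x, R + 1 < ‖x‖ →
      (-1) ^ m / (m:ℝ) ^ m * iteratedFDeriv ℝ m f x (fun _ => h) = 0 := by
    intro x hx
    rw [hR' x (by linarith)]; simp
  rw [← integral_sub (bbm_cont_int _ hcT _ hTz p (by linarith))
    (bbm_cont_int _ hcL _ hLz p (by linarith))]
  have hb : ∀ x, |(|Rm m f x (x + h)| ^ p -
      |(-1) ^ m / (m:ℝ) ^ m * iteratedFDeriv ℝ m f x (fun _ => h)| ^ p)| ≤
      p * (C + M) ^ (p - 1) * C * (‖h‖ ^ ((m:ℝ) * p) * ‖h‖) := by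
    intro x
    have hL1 : |(-1) ^ m / (m:ℝ) ^ m * iteratedFDeriv ℝ m f x (fun _ => h)| ≤ M * ‖h‖ ^ m := by
      rw [abs_mul, abs_div, abs_pow, abs_neg, abs_one, one_pow,
      abs_of_pos (show (0:ℝ) < (m:ℝ) ^ m by positivity)]
      refine (mul_le_of_le_one_left (abs_nonneg _) ?_).trans (hM x h)
      exact div_le_one_of_le₀ (one_le_pow₀ hm1) (by positivity)
    have hp1' : ‖h‖ ^ (m + 1) ≤ ‖h‖ ^ m := pow_le_pow_of_le_one (norm_nonneg _) hh (Nat.le_succ m)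
    have hd := hC x h
    have hT1 : |Rm m f x (x + h)| ≤ (C + M) * ‖h‖ ^ m := by
      have h3 := abs_sub_abs_le_abs_sub (Rm m f x (x + h))
        ((-1) ^ m / (m:ℝ) ^ m * iteratedFDeriv ℝ m f x (fun _ => h))
      have h4 : C * ‖h‖ ^ (m + 1) ≤ C * ‖h‖ ^ m := by gcongr
      linarith
    have h5 := bbm_rpow_diff p hp1.le ((C + M) * ‖h‖ ^ m) _ _ hT1 (hL1.trans (by
      gcongr; linarith))
    refine h5.trans ?_
    rw [Real.mul_rpow (by positivity) (by positivity)]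
    calc _ ≤ p * ((C + M) ^ (p - 1) * (‖h‖ ^ m) ^ (p - 1)) * (C * ‖h‖ ^ (m + 1)) := by gcongr
      _ = p * (C + M) ^ (p - 1) * C * ((‖h‖ ^ m) ^ (p - 1) * ‖h‖ ^ m * ‖h‖) := by ring
      _ = _ := by
        rw [← Real.rpow_add_one' (by positivity) (by linarith), sub_add_cancel,
          Real.rpow_mul (norm_nonneg _), Real.rpow_natCast]
  refine (bbm_int_bound _ (R + 1) (fun x hx => ?_) _ hb).trans_eq (by ring)
  rw [hTz x hx, hLz x hx, sub_self]

lemma bbm_total_bound {N : ℕ} (m : ℕ) (hm : 0 < m) (p : ℝ) (hp1 : 1 < p) (f : E N → ℝ)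
    (hf : ContDiff ℝ (m + 1) f) (hsupp : HasCompactSupport f) : ∃ C : ℝ, 0 ≤ C ∧
      ∀ h : E N, |(∫ x, |Rm m f x (x + h)| ^ p) -
        ((m:ℝ) ^ ((m:ℝ) * p))⁻¹ * ∫ x, |iteratedFDeriv ℝ m f x (fun _ => h)| ^ p| ≤
          C * ‖h‖ ^ ((m:ℝ) * p) * min 1 ‖h‖ := by
  obtain ⟨C1, h10, h1⟩ := bbm_G_bound m hm p hp1 f hf.continuous hsupp
  obtain ⟨C2, h20, h2⟩ := bbm_g_bound m p hp1 f hf hsupp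
  obtain ⟨C3, h30, h3⟩ := bbm_diff_bound m hm p hp1 f hf hsupp
  have hm1 : (1:ℝ) ≤ m := by exact_mod_cast hm
  have hmp : 0 ≤ (m:ℝ) * p := by positivity
  refine ⟨C1 + C2 + C3, by positivity, fun h => ?_⟩
  rcases le_or_gt ‖h‖ 1 with hh | hh
  · rw [min_eq_right hh]
    refine (h3 h hh).trans ?_
    gcongr
    linarith
  · rw [min_eq_left hh.le, mul_one]
    have hpow : 1 ≤ ‖h‖ ^ ((m:ℝ) * p) := Real.one_le_rpow hh.le hmp
    have hmm : ((m:ℝ) ^ ((m:ℝ) * p))⁻¹ ≤ 1 := inv_le_one_of_one_le₀ (Real.one_le_rpow hm1 hmp)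
    have hG0 : 0 ≤ ∫ x, |Rm m f x (x + h)| ^ p := integral_nonneg fun x => by positivity
    have hg0 : 0 ≤ ∫ x, |iteratedFDeriv ℝ m f x (fun _ => h)| ^ p :=
      integral_nonneg fun x => by positivity
    have hk0 : 0 ≤ ((m:ℝ) ^ ((m:ℝ) * p))⁻¹ := by positivity
    have e1 := h1 h
    have e2 := h2 h
    have e3 : ((m:ℝ) ^ ((m:ℝ) * p))⁻¹ * ∫ x, |iteratedFDeriv ℝ m f x (fun _ => h)| ^ p ≤
      C2 * ‖h‖ ^ ((m:ℝ) * p) := (mul_le_of_le_one_left hg0 hmm).trans e2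
    have e4 := mul_nonneg hk0 hg0
    have e5 : C1 ≤ C1 * ‖h‖ ^ ((m:ℝ) * p) := le_mul_of_one_le_right h10 hpow
    have e6 : 0 ≤ C3 * ‖h‖ ^ ((m:ℝ) * p) := by positivity
    have e7 : 0 ≤ C2 * ‖h‖ ^ ((m:ℝ) * p) := by positivity
    have e8 : 0 ≤ C1 * ‖h‖ ^ ((m:ℝ) * p) := by positivity
    rw [abs_le]
    constructor <;> nlinarith

lemma bbm_J_tendsto {N : ℕ} (B : ℝ) (hB : 0 < B)
    (ρ : ℝ → ℝ → ℝ) (hρnn : ∀ ε > 0, ∀ r : ℝ, 0 ≤ ρ ε r)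
    (hρ1 : ∀ ε > 0, ∫ r in Set.Ioi (0 : ℝ), r ^ (N - 1) * ρ ε r = 1)
    (hρi : ∀ ε > 0, IntegrableOn (fun r => r ^ (N - 1) * ρ ε r) (Ioi (0:ℝ)))
    (hρ2 : ∀ δ > 0, Tendsto (fun ε => ∫ r in Set.Ioi δ, r ^ (N - 1) * ρ ε r)
      (nhdsWithin 0 (Set.Ioi 0)) (nhds 0)) :
    (∀ ε > 0, IntegrableOn (fun r => r ^ (N - 1) * (min 1 (B * r) * ρ ε r)) (Ioi (0:ℝ))) ∧
    Tendsto (fun ε => ∫ r in Set.Ioi (0:ℝ), r ^ (N - 1) * (min 1 (B * r) * ρ ε r))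
      (nhdsWithin 0 (Set.Ioi 0)) (nhds 0) := by
  have hint : ∀ ε > 0,
      IntegrableOn (fun r => r ^ (N - 1) * (min 1 (B * r) * ρ ε r)) (Ioi (0:ℝ)) := by
    intro ε hε
    have h1 : IntegrableOn (fun r => min 1 (B * r) * (r ^ (N - 1) * ρ ε r)) (Ioi (0:ℝ)) := by
      refine Integrable.bdd_mul (c := 1) (hρi ε hε) ?_ ?_
      · exact (by fun_prop : Continuous fun r : ℝ => min 1 (B * r)).aestronglyMeasurable
      · refine (ae_restrict_iff' measurableSet_Ioi).2 (ae_of_all _ fun r hr => ?_)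
        have hr' : 0 < r := hr
        rw [Real.norm_of_nonneg (by positivity)]
        exact min_le_left _ _
    refine h1.congr (ae_of_all _ fun r => ?_)
    simp only; ring
  refine ⟨hint, ?_⟩
  rw [Metric.tendsto_nhds]
  intro η hη
  set δ : ℝ := η / (2 * B) with hδ
  have hδ0 : 0 < δ := by positivity
  have h2 := (Metric.tendsto_nhds.1 (hρ2 δ hδ0)) (η / 2) (by positivity)
  filter_upwards [h2, self_mem_nhdsWithin] with ε h3 hε
  have hε' : 0 < ε := hε
  rw [Real.dist_eq, sub_zero] at h3 ⊢
  have hnn : 0 ≤ ∫ r in Set.Ioi (0:ℝ), r ^ (N - 1) * (min 1 (B * r) * ρ ε r) := by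
    refine setIntegral_nonneg measurableSet_Ioi fun r hr => ?_
    have hr' : 0 < r := hr
    have := hρnn ε hε' r
    positivity
  rw [abs_of_nonneg hnn]
  have hsub : Ioi δ ⊆ Ioi (0:ℝ) := Ioi_subset_Ioi hδ0.le
  have hind : IntegrableOn ((Ioi δ).indicator fun r => r ^ (N - 1) * ρ ε r) (Ioi (0:ℝ)) :=
    (hρi ε hε').indicator measurableSet_Ioi
  have h4 : ∫ r in Set.Ioi (0:ℝ), r ^ (N - 1) * (min 1 (B * r) * ρ ε r) ≤
      ∫ r in Ioi (0:ℝ), (B * δ * (r ^ (N - 1) * ρ ε r) +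
        (Ioi δ).indicator (fun r => r ^ (N - 1) * ρ ε r) r) := by
    refine setIntegral_mono_on (hint ε hε') (((hρi ε hε').const_mul _).add hind)
      measurableSet_Ioi fun r hr => ?_
    have hr' : 0 < r := hr
    have hρ0 := hρnn ε hε' r
    have hq : 0 ≤ r ^ (N - 1) * ρ ε r := by positivity
    by_cases hrd : r ∈ Ioi δ
    · rw [indicator_of_mem hrd]
      have : min 1 (B * r) ≤ 1 := min_le_left _ _
      have h5 : 0 ≤ B * δ * (r ^ (N - 1) * ρ ε r) := by positivity
      nlinarith
    · rw [indicator_of_notMem hrd]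
      have h6 : r ≤ δ := by simpa using hrd
      have : min 1 (B * r) ≤ B * δ := (min_le_right _ _).trans (by gcongr)
      nlinarith
  rw [integral_add ((hρi ε hε').const_mul _) hind, integral_const_mul, hρ1 ε hε',
    setIntegral_indicator measurableSet_Ioi, inter_eq_self_of_subset_right hsub] at h4
  have h7 : B * δ = η / 2 := by rw [hδ]; field_simp
  have h8 := le_abs_self (∫ r in Ioi δ, r ^ (N - 1) * ρ ε r)
  linarith

lemma bbm_abstract {N : ℕ} (hN : 0 < N) (m : ℕ) (hm : 0 < m) (p : ℝ) (hp1 : 1 < p)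
    (γ : E N → ℝ) (hγc : Continuous γ) (hγ0 : γ 0 = 0)
    (hγs : ∀ t : ℝ, 0 < t → ∀ x, γ (t • x) = t * γ x) (hγneg : ∀ x, γ (-x) = γ x)
    (B : ℝ) (hB : 0 < B) (hγB : ∀ x, ‖x‖ ≤ B * γ x)
    (f : E N → ℝ) (hf : ContDiff ℝ (m + 1) f) (hsupp : HasCompactSupport f)
    (ρ : ℝ → ℝ → ℝ) (hρnn : ∀ ε > 0, ∀ r : ℝ, 0 ≤ ρ ε r)
    (hρ1 : ∀ ε > 0, ∫ r in Set.Ioi (0 : ℝ), r ^ (N - 1) * ρ ε r = 1)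
    (hρ2 : ∀ δ > 0, Tendsto (fun ε => ∫ r in Set.Ioi δ, r ^ (N - 1) * ρ ε r)
      (nhdsWithin 0 (Set.Ioi 0)) (nhds 0)) :
    Tendsto (fun ε : ℝ =>
        ∫ q : E N × E N, |Rm m f q.1 q.2| ^ p / γ (q.1 - q.2) ^ ((m : ℝ) * p) *
          ρ ε (γ (q.1 - q.2)))
      (nhdsWithin 0 (Set.Ioi 0))
      (nhds (((N : ℝ) + m * p) / (m : ℝ) ^ ((m : ℝ) * p) *
        ∫ y in {y | γ y ≤ 1}, ∫ x, |iteratedFDeriv ℝ m f x (fun _ => y)| ^ p)) := by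
  have hγnn : ∀ x, 0 ≤ γ x := fun x =>
    nonneg_of_mul_nonneg_right ((norm_nonneg x).trans (hγB x)) hB
  have hγpos : ∀ x, x ≠ 0 → 0 < γ x := fun x hx =>
    pos_of_mul_pos_right ((norm_pos_iff.2 hx).trans_le (hγB x)) hB.le
  have hρi : ∀ ε > 0, IntegrableOn (fun r => r ^ (N - 1) * ρ ε r) (Ioi (0:ℝ)) := by
    intro ε hε
    by_contra hcon
    have := hρ1 ε hε
    rw [integral_undef hcon] at this
    exact zero_ne_one this
  have hmp : 0 < (m:ℝ) * p := by positivity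
  have hN1 : (1:ℝ) ≤ N := by exact_mod_cast hN
  have hNc : ((N - 1 : ℕ) : ℝ) = N - 1 := by rw [Nat.cast_sub hN]; simp
  obtain ⟨C, hC0, hC⟩ := bbm_total_bound m hm p hp1 f hf hsupp
  obtain ⟨C2, hC20, hC2⟩ := bbm_g_bound m p hp1 f hf hsupp
  obtain ⟨hJi, hJ⟩ := bbm_J_tendsto B hB ρ hρnn hρ1 hρi hρ2
  set G : E N → ℝ := fun h => ∫ x, |Rm m f x (x + h)| ^ p with hG
  set g : E N → ℝ := fun h => ∫ x, |iteratedFDeriv ℝ m f x (fun _ => h)| ^ p with hg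
  set κ : ℝ := ((m:ℝ) ^ ((m:ℝ) * p))⁻¹ with hκ
  have hTc : Continuous (fun z : E N × E N => |Rm m f z.1 (z.1 + z.2)| ^ p) :=
    (bbm_T_cont m f hf.continuous).abs.rpow_const (fun _ => Or.inr (by linarith))
  have hLc : Continuous (fun z : E N × E N => |iteratedFDeriv ℝ m f z.1 (fun _ => z.2)| ^ p) :=
    (bbm_L_cont m f hf).abs.rpow_const (fun _ => Or.inr (by linarith))
  have hGm : Measurable G := (hTc.stronglyMeasurable.integral_prod_left').measurable
  have hgm : Measurable g := (hLc.stronglyMeasurable.integral_prod_left').measurable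
  have hG0 : ∀ h, 0 ≤ G h := fun h => integral_nonneg fun x => by positivity
  have hg0 : ∀ h, 0 ≤ g h := fun h => integral_nonneg fun x => by positivity
  have hbdd : {x | γ x ≤ 1} ⊆ Metric.closedBall 0 B := by
    intro x hx
    have h1 : γ x ≤ 1 := hx
    have h2 := hγB x
    simp only [Metric.mem_closedBall, dist_zero_right]
    nlinarith
  have hvol : volume {x | γ x ≤ 1} < ⊤ := (measure_mono hbdd).trans_lt measure_closedBall_lt_top
  have hms : MeasurableSet {x | γ x ≤ 1} := measurableSet_le hγc.measurable measurable_const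
  have hgi : IntegrableOn g {x | γ x ≤ 1} := by
    refine Measure.integrableOn_of_bounded (M := C2 * B ^ ((m:ℝ) * p)) hvol.ne
      hgm.aestronglyMeasurable ?_
    refine (ae_restrict_iff' hms).2 (ae_of_all _ fun x hx => ?_)
    rw [Real.norm_of_nonneg (hg0 x)]
    refine (hC2 x).trans ?_
    gcongr
    simpa using hbdd hx
  have hgs : ∀ t : ℝ, 0 < t → ∀ x, g (t • x) = t ^ ((m:ℝ) * p) * g x := by
    intro t ht y
    simp only [hg]
    rw [← integral_const_mul]
    congr 1
    ext x
    have := (iteratedFDeriv ℝ m f x).map_smul_univ (fun _ => t) (fun _ => y)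
    simp only [Finset.prod_const, Finset.card_univ, Fintype.card_fin] at this
    rw [this, smul_eq_mul, abs_mul, abs_of_pos (by positivity),
      Real.mul_rpow (by positivity) (by positivity), Real.rpow_mul ht.le, Real.rpow_natCast]
  -- polar for weight one
  have hpol1 := fun H hH => bbm_polar_integral hN γ hγc hγpos hγs (fun _ => (1:ℝ))
    (fun _ => zero_le_one) measurable_const 0 le_rfl (by simp)
    (integrableOn_const hvol.ne) H hH
  have hpolg := fun H hH => bbm_polar_integral hN γ hγc hγpos hγs g hg0 hgm ((m:ℝ) * p) hmp.le hgs
    hgi H hH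
  have hpw : ∀ r : ℝ, r ^ ((N:ℝ) + 0 - 1) = r ^ (N - 1) := by
    intro r
    rw [add_zero, ← hNc, Real.rpow_natCast]
  have hpwg : ∀ ε, ∀ r ∈ Ioi (0:ℝ), r ^ (N - 1) * ρ ε r =
      r ^ ((N:ℝ) + m * p - 1) * ((r ^ ((m:ℝ) * p))⁻¹ * ρ ε r) := by
    intro ε r hr
    have hr' : 0 < r := hr
    have : (N:ℝ) + m * p - 1 = (N - 1 : ℕ) + m * p := by rw [hNc]; ring
    rw [this, Real.rpow_add hr', Real.rpow_natCast]
    have : r ^ ((m:ℝ) * p) ≠ 0 := by positivity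
    field_simp
  -- facts for each ε
  have hw : ∀ ε > 0, Integrable (fun h => ρ ε (γ h)) := by
    intro ε hε
    have := (hpol1 (ρ ε) (by simp_rw [hpw]; exact hρi ε hε)).1
    simpa using this
  have hgw : ∀ ε > 0, Integrable (fun h => g h * ((γ h ^ ((m:ℝ) * p))⁻¹ * ρ ε (γ h))) ∧
      ∫ h, g h * ((γ h ^ ((m:ℝ) * p))⁻¹ * ρ ε (γ h)) =
        ((N:ℝ) + m * p) * ∫ y in {y | γ y ≤ 1}, g y := by
    intro ε hε
    have h1 := hpolg (fun r => (r ^ ((m:ℝ) * p))⁻¹ * ρ ε r)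
      ((hρi ε hε).congr_fun (hpwg ε) measurableSet_Ioi)
    refine ⟨h1.1, h1.2.trans ?_⟩
    rw [← setIntegral_congr_fun measurableSet_Ioi (hpwg ε), hρ1 ε hε, mul_one]
  have hmin : ∀ ε > 0, Integrable (fun h => min 1 (B * γ h) * ρ ε (γ h)) ∧
      ∫ h, min 1 (B * γ h) * ρ ε (γ h) = (N * (∫ x in {x | γ x ≤ 1}, (1:ℝ))) *
        ∫ r in Set.Ioi (0:ℝ), r ^ (N - 1) * (min 1 (B * r) * ρ ε r) := by
    intro ε hε
    have h1 := hpol1 (fun r => min 1 (B * r) * ρ ε r) (by simp_rw [hpw]; exact hJi ε hε)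
    simp_rw [hpw, one_mul, add_zero] at h1
    exact h1
  have hDle : ∀ ε > 0, ∀ h, ‖(G h - κ * g h) * ((γ h ^ ((m:ℝ) * p))⁻¹ * ρ ε (γ h))‖ ≤
      C * B ^ ((m:ℝ) * p) * (min 1 (B * γ h) * ρ ε (γ h)) := by
    intro ε hε h
    have hρ0 := hρnn ε hε (γ h)
    have hγh := hγnn h
    rcases eq_or_ne h 0 with rfl | hne
    · rw [hγ0, Real.zero_rpow hmp.ne']; simp
    have hγp := hγpos h hne
    rw [Real.norm_eq_abs, abs_mul, abs_of_nonneg (a := (γ h ^ ((m:ℝ) * p))⁻¹ * ρ ε (γ h))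
      (by positivity), ← mul_assoc, ← mul_assoc]
    refine mul_le_mul_of_nonneg_right ?_ hρ0
    rw [← div_eq_mul_inv, div_le_iff₀ (by positivity)]
    refine (hC h).trans ?_
    calc C * ‖h‖ ^ ((m:ℝ) * p) * min 1 ‖h‖
        ≤ C * (B * γ h) ^ ((m:ℝ) * p) * min 1 (B * γ h) := by
          have := hγB h
          gcongr
      _ = _ := by rw [Real.mul_rpow hB.le hγh]; ring
  have hDm : ∀ ε > 0, AEStronglyMeasurable
      (fun h => (G h - κ * g h) * ((γ h ^ ((m:ℝ) * p))⁻¹ * ρ ε (γ h))) := by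
    intro ε hε
    have h1 : Measurable (fun h => (γ h ^ ((m:ℝ) * p))⁻¹) :=
      (hγc.measurable.pow_const _).inv
    exact (hGm.sub (hgm.const_mul κ)).aestronglyMeasurable.mul
      (h1.aestronglyMeasurable.mul (hw ε hε).1)
  have hDi : ∀ ε > 0, Integrable
      (fun h => (G h - κ * g h) * ((γ h ^ ((m:ℝ) * p))⁻¹ * ρ ε (γ h))) := by
    intro ε hε
    exact ((hmin ε hε).1.const_mul _).mono' (hDm ε hε) (ae_of_all _ (hDle ε hε))
  have hGi : ∀ ε > 0, Integrable (fun h => G h * ((γ h ^ ((m:ℝ) * p))⁻¹ * ρ ε (γ h))) := by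
    intro ε hε
    refine ((hDi ε hε).add ((hgw ε hε).1.const_mul κ)).congr (ae_of_all _ fun h => ?_)
    simp only [Pi.add_apply]; ring
  have hGval : ∀ ε > 0, ∫ h, G h * ((γ h ^ ((m:ℝ) * p))⁻¹ * ρ ε (γ h)) =
      (∫ h, (G h - κ * g h) * ((γ h ^ ((m:ℝ) * p))⁻¹ * ρ ε (γ h))) +
        κ * (((N:ℝ) + m * p) * ∫ y in {y | γ y ≤ 1}, g y) := by
    intro ε hε
    rw [← (hgw ε hε).2, ← integral_const_mul,
      ← integral_add (hDi ε hε) ((hgw ε hε).1.const_mul κ)]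
    congr 1; ext h; ring
  obtain ⟨R, hR, -⟩ := bbm_supp_radius m f hsupp
  have hLHS : ∀ ε > 0, ∫ q : E N × E N, |Rm m f q.1 q.2| ^ p / γ (q.1 - q.2) ^ ((m : ℝ) * p) *
          ρ ε (γ (q.1 - q.2)) = ∫ h, G h * ((γ h ^ ((m:ℝ) * p))⁻¹ * ρ ε (γ h)) := by
    intro ε hε
    have hmp' : MeasurePreserving (fun z : E N × E N => (z.1, z.1 + z.2)) :=
      measurePreserving_prod_add volume volume
    have hemb : MeasurableEmbedding (fun z : E N × E N => (z.1, z.1 + z.2)) :=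
      (MeasurableEquiv.shearAddRight (E N)).measurableEmbedding
    rw [← hmp'.integral_comp hemb]
    have hs : ∀ z : E N × E N, γ (z.1 - (z.1 + z.2)) = γ z.2 := by
      intro z
      rw [← hγneg z.2]; congr 1; abel
    simp_rw [hs, div_eq_mul_inv, mul_assoc]
    have hw1 : Measurable (fun h => (γ h ^ ((m:ℝ) * p))⁻¹) :=
      (hγc.measurable.pow_const _).inv
    have hwm : AEStronglyMeasurable (fun h => (γ h ^ ((m:ℝ) * p))⁻¹ * ρ ε (γ h)) :=
      hw1.aestronglyMeasurable.mul (hw ε hε).1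
    have hx : ∀ h, Integrable (fun x => |Rm m f x (x + h)| ^ p) := fun h =>
      bbm_cont_int (fun x => Rm m f x (x + h))
        ((bbm_T_cont m f hf.continuous).comp (continuous_id.prodMk continuous_const)) (R + ‖h‖)
        (fun x hx => bbm_T_supp m hm f R hR h x hx) p (by linarith)
    have hpi : Integrable (fun z : E N × E N => |Rm m f z.1 (z.1 + z.2)| ^ p *
        ((γ z.2 ^ ((m:ℝ) * p))⁻¹ * ρ ε (γ z.2))) (volume.prod volume) := by
      have hms' : AEStronglyMeasurable (fun z : E N × E N => |Rm m f z.1 (z.1 + z.2)| ^ p *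
        ((γ z.2 ^ ((m:ℝ) * p))⁻¹ * ρ ε (γ z.2))) (volume.prod volume) :=
        hTc.aestronglyMeasurable.mul hwm.comp_snd
      refine (integrable_prod_iff' hms').2 ?_
      refine ⟨ae_of_all _ fun h =>
        (hx h).mul_const ((γ h ^ ((m:ℝ) * p))⁻¹ * ρ ε (γ h)), ?_⟩
      refine (hGi ε hε).congr (ae_of_all _ fun h => ?_)
      simp only [hG]
      rw [← integral_mul_const]
      congr 1; ext x
      have := hρnn ε hε (γ h)
      have := hγnn h
      rw [Real.norm_of_nonneg (by positivity)]
    rw [Measure.volume_eq_prod, integral_prod_symm _ hpi]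
    congr 1; ext h
    simp only [hG]
    rw [← integral_mul_const]
  have hlim : Tendsto (fun ε => ∫ h, (G h - κ * g h) * ((γ h ^ ((m:ℝ) * p))⁻¹ * ρ ε (γ h)))
      (nhdsWithin 0 (Set.Ioi 0)) (nhds 0) := by
    have h0 := hJ.const_mul (C * B ^ ((m:ℝ) * p) * (N * (∫ x in {x | γ x ≤ 1}, (1:ℝ))))
    rw [mul_zero] at h0
    refine squeeze_zero_norm' ?_ h0
    filter_upwards [self_mem_nhdsWithin] with ε hε
    have := norm_integral_le_of_norm_le ((hmin ε hε).1.const_mul (C * B ^ ((m:ℝ) * p)))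
      (ae_of_all _ (hDle ε hε))
    rw [integral_const_mul, (hmin ε hε).2, ← mul_assoc] at this
    exact this
  have hfinal := hlim.add_const (κ * (((N:ℝ) + m * p) * ∫ y in {y | γ y ≤ 1}, g y))
  rw [zero_add] at hfinal
  have hval : ((N : ℝ) + m * p) / (m : ℝ) ^ ((m : ℝ) * p) * ∫ y in {y | γ y ≤ 1}, g y =
      κ * (((N:ℝ) + m * p) * ∫ y in {y | γ y ≤ 1}, g y) := by
    rw [hκ]; ring
  rw [hval]
  refine hfinal.congr' ?_
  filter_upwards [self_mem_nhdsWithin] with ε hε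
  rw [hLHS ε hε, hGval ε hε]

lemma bbm_swap {N : ℕ} (m : ℕ) (p : ℝ) (hp1 : 1 < p)
    (K : Set (E N)) (hKbd : Bornology.IsBounded K)
    (f : E N → ℝ) (hf : ContDiff ℝ (m + 1) f) (hsupp : HasCompactSupport f) :
    ∫ x, ∫ y in K, |iteratedFDeriv ℝ m f x (fun _ => y)| ^ p =
      ∫ y in K, ∫ x, |iteratedFDeriv ℝ m f x (fun _ => y)| ^ p := by
  apply integral_integral_swap
  obtain ⟨R, -, hR⟩ := bbm_supp_radius m f hsupp
  obtain ⟨B, hB⟩ := hKbd.subset_closedBall (0 : E N)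
  have hLc : Continuous (fun z : E N × E N => |iteratedFDeriv ℝ m f z.1 (fun _ => z.2)| ^ p) :=
    (bbm_L_cont m f hf).abs.rpow_const (fun _ => Or.inr (by linarith))
  have hc : IntegrableOn (fun z : E N × E N => |iteratedFDeriv ℝ m f z.1 (fun _ => z.2)| ^ p)
      (Metric.closedBall 0 R ×ˢ Metric.closedBall 0 B) (volume.prod volume) :=
    hLc.continuousOn.integrableOn_compact
      ((isCompact_closedBall _ _).prod (isCompact_closedBall _ _))
  have h2 : IntegrableOn (fun z : E N × E N => |iteratedFDeriv ℝ m f z.1 (fun _ => z.2)| ^ p)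
      (univ ×ˢ Metric.closedBall 0 B) (volume.prod volume) := by
    refine hc.of_forall_sdiff_eq_zero (MeasurableSet.univ.prod measurableSet_closedBall) ?_
    rintro ⟨x, y⟩ ⟨h1, h2⟩
    have hx : R < ‖x‖ := by
      by_contra hcon
      exact h2 ⟨by simpa using hcon, h1.2⟩
    simp [hR x hx, Real.zero_rpow (by linarith : p ≠ 0)]
  rw [IntegrableOn, ← Measure.prod_restrict, Measure.restrict_univ] at h2
  exact h2.mono_measure (Measure.prod_mono le_rfl (Measure.restrict_mono hB le_rfl))

theorem bbm_formula_smooth {N : ℕ} (m : ℕ) (hm : 0 < m) (p : ℝ) (hp1 : 1 < p)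
    (K : Set (E N)) (hKconv : Convex ℝ K) (hKsym : ∀ x ∈ K, -x ∈ K)
    (hK0 : (0 : E N) ∈ K) (hKint : (interior K).Nonempty)
    (hKbd : Bornology.IsBounded K)
    (f : E N → ℝ) (hf : ContDiff ℝ (m + 1) f) (hsupp : HasCompactSupport f)
    (ρ : ℝ → ℝ → ℝ) (hρnn : ∀ ε > 0, ∀ r : ℝ, 0 ≤ ρ ε r)
    (hρ1 : ∀ ε > 0, ∫ r in Set.Ioi (0 : ℝ), r ^ (N - 1) * ρ ε r = 1)
    (hρ2 : ∀ δ > 0, Tendsto (fun ε => ∫ r in Set.Ioi δ, r ^ (N - 1) * ρ ε r)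
      (nhdsWithin 0 (Set.Ioi 0)) (nhds 0)) :
    Tendsto (fun ε : ℝ =>
        ∫ q : E N × E N, |Rm m f q.1 q.2| ^ p / gauge K (q.1 - q.2) ^ ((m : ℝ) * p) *
          ρ ε (gauge K (q.1 - q.2)))
      (nhdsWithin 0 (Set.Ioi 0))
      (nhds (((N : ℝ) + m * p) / (m : ℝ) ^ ((m : ℝ) * p) *
        ∫ x, ∫ y in K, |iteratedFDeriv ℝ m f x (fun _ => y)| ^ p)) := by
  rcases Nat.eq_zero_or_pos N with rfl | hN
  · have hmp : 0 < (m:ℝ) * p := by positivity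
    have hz : ∀ x : E 0, x = 0 := fun x => Subsingleton.elim _ _
    have h1 : ∀ q : E 0 × E 0, gauge K (q.1 - q.2) = 0 := fun q => by
      rw [hz (q.1 - q.2), gauge_zero]
    simp_rw [h1, Real.zero_rpow hmp.ne']
    have h2 : ∀ x y : E 0, iteratedFDeriv ℝ m f x (fun _ => y) = 0 := fun x y =>
      (iteratedFDeriv ℝ m f x).map_coord_zero ⟨0, hm⟩ (hz y)
    simp_rw [h2, abs_zero, Real.zero_rpow (by linarith : p ≠ 0)]
    simp
  have hKn : K ∈ nhds (0 : E N) := by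
    obtain ⟨x, hx⟩ := hKint
    have hneg : -K = K := by
      ext y
      refine ⟨fun hy => by simpa using hKsym _ hy, fun hy => hKsym _ hy⟩
    have hx' : -x ∈ interior K := by
      have : -interior K = interior K := by
        conv_rhs => rw [← hneg]
        exact ((Homeomorph.neg (E N)).preimage_interior K)
      rw [← this]; simpa using hx
    have hm0 := hKconv.interior hx hx' (show (0:ℝ) ≤ 1/2 by norm_num)
      (show (0:ℝ) ≤ 1/2 by norm_num) (by norm_num)
    simp at hm0
    exact mem_interior_iff_mem_nhds.1 hm0
  obtain ⟨B, hB0, hB⟩ := hKbd.subset_closedBall_lt 0 (0 : E N)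
  have habs : Absorbent ℝ K := absorbent_nhds_zero hKn
  have hae : ({y | gauge K y ≤ 1} : Set (E N)) =ᵐ[volume] K := by
    have h1 : {y | gauge K y ≤ 1} = closure K := by
      ext y; exact gauge_le_one_iff_mem_closure hKconv hKn
    rw [h1]
    exact closure_ae_eq_of_null_frontier (hKconv.addHaar_frontier volume)
  have := bbm_abstract hN m hm p hp1 (gauge K) (continuous_gauge hKconv hKn) gauge_zero
    (fun t ht x => by rw [gauge_smul_of_nonneg ht.le, smul_eq_mul]) (gauge_neg hKsym) B hB0
    (fun x => by
      have := le_gauge_of_subset_closedBall (x := x) habs hB0.le hB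
      rw [div_le_iff₀ hB0] at this
      linarith) f hf hsupp ρ hρnn hρ1 hρ2
  rw [setIntegral_congr_set hae] at this
  rw [bbm_swap m p hp1 K hKbd f hf hsupp]
  exact this
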